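/- arXiv:2110.11382 — 3 statements merged into one kernel-verified Lean document; each statement's English description precedes it below -/
import Mathlib

section
/- Let n ≥ 1, let r ≥ 0, and let x¹,…,xᵐ ∈ ℝⁿ be data points with Euclidean norm ‖xⁱ‖₂ ≤ r, with labels y¹,…,yᵐ ∈ {0,1}. Fix layer dimensions d₀ = n, d₁,…,d_K and a loss function ℓ : {0,1} × ℝ^{d_K} → ℝ. Let M₁ > n·r + 1 and M_k > d_{k-1} + 1 for k = 2,…,K. Then the infimum, over all real weight matrices W^k ∈ ℝ^{d_k×d_{k-1}} and thresholds λ_k ∈ ℝ (k = 1,…,K), of Σᵢ ℓ(yⁱ, f_{W,λ}(xⁱ)) — where f_{W,λ} is the binarized network defined by h⁰ = x and h^k_j = 1 if (W^k h^{k-1})_j ≥ λ_k and 0 otherwise — equals the infimum of Σᵢ ℓ(yⁱ, u^{i,K}) over all W^k with entries in [−1,1], λ_k ∈ [−1,1], and binary vectors u^{i,k} ∈ {0,1}^{d_k} satisfying, componentwise for all i and k: W¹xⁱ < M₁u^{i,1} + λ₁𝟙, W¹xⁱ ≥ M₁(u^{i,1} − 𝟙) + λ₁𝟙, and for k ≥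 2: W^k u^{i,k−1} < M_k u^{i,k} + λ_k𝟙, W^k u^{i,k−1} ≥ M_k(u^{i,k} − 𝟙) + λ_k𝟙. -/
/-- The binarized deep neural network: `bdnn d W lam x k` is the output of the `k`-th layer
on input `x`, where layer `k+1` applies weight matrix `W k` and threshold `lam k`
followed by the binary activation `α ↦ if α ≥ λ then 1 else 0`. -/
noncomputable def bdnn (d : ℕ → ℕ) (W : ∀ k, Matrix (Fin (d (k + 1))) (Fin (d k)) ℝ)
    (lam : ℕ → ℝ) (x : Fin (d 0) → ℝ) : (k : ℕ) → Fin (d k) → ℝ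
  | 0 => x
  | k + 1 => fun j => if lam k ≤ (W k).mulVec (bdnn d W lam x k) j then 1 else 0

/-- Rescaling every layer by a positive factor does not change the network. -/
theorem bdnn_smul (d : ℕ → ℕ) (W : ∀ k, Matrix (Fin (d (k + 1))) (Fin (d k)) ℝ)
    (lam c : ℕ → ℝ) (hc : ∀ k, 0 < c k) (x : Fin (d 0) → ℝ) (k : ℕ) :
    bdnn d (fun k => c k • W k) (fun k => c k * lam k) x k = bdnn d W lam x k := by
  induction k with
  | zero => rfl
  | succ k ih =>
    funext j
    simp only [bdnn, ih, Matrix.smul_mulVec, Pi.smul_apply, smul_eq_mul,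
      mul_le_mul_iff_right₀ (hc k)]

theorem bdnn_succ_eq_zero_or_one (d : ℕ → ℕ)
    (W : ∀ k, Matrix (Fin (d (k + 1))) (Fin (d k)) ℝ)
    (lam : ℕ → ℝ) (x : Fin (d 0) → ℝ) (k : ℕ) (j : Fin (d (k + 1))) :
    bdnn d W lam x (k + 1) j = 0 ∨ bdnn d W lam x (k + 1) j = 1 := by
  simp only [bdnn]
  split_ifs <;> simp

theorem abs_mulVec_le {p q : ℕ} (A : Matrix (Fin p) (Fin q) ℝ) (v : Fin q → ℝ) (r : ℝ)
    (j : Fin p) (hA : ∀ l, |A j l| ≤ 1) (hv : ∀ l, |v l| ≤ r) :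
    |A.mulVec v j| ≤ q * r := by
  calc |A.mulVec v j| ≤ ∑ l, |A j l * v l| := by
        simp only [Matrix.mulVec, dotProduct]
        exact Finset.abs_sum_le_sum_abs _ _
    _ ≤ ∑ _l : Fin q, r := Finset.sum_le_sum fun l _ => by
        rw [abs_mul]
        exact (mul_le_of_le_one_left (abs_nonneg _) (hA l)).trans (hv l)
    _ = q * r := by simp

/-- The big-M inequalities hold when the binary variable is the threshold indicator. -/
theorem bigM_threshold {w l B M : ℝ} (hw : |w| ≤ B) (hl : |l| ≤ 1) (hM : B + 1 < M) :
    w < M * (if l ≤ w then 1 else 0) + l ∧ M * ((if l ≤ w then 1 else 0) - 1) + l ≤ w := by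
  rw [abs_le] at hw hl
  split_ifs with h
  · constructor <;> linarith
  · constructor <;> linarith

/-- Binary solutions of the big-M inequalities are threshold indicators. -/
theorem threshold_of_bigM {w l u M : ℝ} (hu : u = 0 ∨ u = 1) (h₁ : w < M * u + l)
    (h₂ : M * (u - 1) + l ≤ w) : (if l ≤ w then (1 : ℝ) else 0) = u := by
  rcases hu with rfl | rfl
  · exact if_neg (by linarith)
  · exact if_pos (by linarith)

/-- A finite layer can be rescaled to have weights and threshold in `[-1, 1]`. -/
theorem exists_scale {p q : ℕ} (A : Matrix (Fin p) (Fin q) ℝ) (t : ℝ) :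
    ∃ c : ℝ, 0 < c ∧ (∀ j l, |c * A j l| ≤ 1) ∧ |c * t| ≤ 1 := by
  have hS : 0 ≤ ∑ j, ∑ l, |A j l| := by positivity
  have hpos : 0 < 1 + |t| + ∑ j, ∑ l, |A j l| := by positivity
  refine ⟨(1 + |t| + ∑ j, ∑ l, |A j l|)⁻¹, inv_pos.2 hpos, fun j l => ?_, ?_⟩
  · rw [abs_mul, abs_of_pos (inv_pos.2 hpos), inv_mul_le_one₀ hpos]
    have h₁ : |A j l| ≤ ∑ l, |A j l| :=
      Finset.single_le_sum (f := fun l => |A j l|) (fun _ _ => abs_nonneg _) (Finset.mem_univ l)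
    have h₂ : ∑ l, |A j l| ≤ ∑ j, ∑ l, |A j l| :=
      Finset.single_le_sum (f := fun j => ∑ l, |A j l|)
        (fun _ _ => Finset.sum_nonneg fun _ _ => abs_nonneg _) (Finset.mem_univ j)
    linarith [abs_nonneg t]
  · rw [abs_mul, abs_of_pos (inv_pos.2 hpos), inv_mul_le_one₀ hpos]
    linarith

/-- The infimum of the empirical loss of the BDNN over all real weights and thresholds equals
the optimal value of the big-M mixed-integer programming formulation with weights and
thresholds restricted to `[-1,1]` and binary activation variables `u`. -/
theorem stmt0 (n m K : ℕ) (hn : 1 ≤ n) (hK : 1 ≤ K) (r : ℝ) (hr : 0 ≤ r)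
    (d : ℕ → ℕ) (hd0 : d 0 = n)
    (x : Fin m → Fin (d 0) → ℝ)
    (hx : ∀ i, Real.sqrt (∑ l, x i l ^ 2) ≤ r)
    (y : Fin m → ℝ) (hy : ∀ i, y i = 0 ∨ y i = 1)
    (loss : ℝ → (Fin (d K) → ℝ) → ℝ)
    (M : ℕ → ℝ) (hM1 : (n : ℝ) * r + 1 < M 0)
    (hMk : ∀ k, 1 ≤ k → k < K → (d k : ℝ) + 1 < M k) :
    sInf { s : ℝ | ∃ (W : ∀ k, Matrix (Fin (d (k + 1))) (Fin (d k)) ℝ) (lam : ℕ → ℝ),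
        s = ∑ i, loss (y i) (bdnn d W lam (x i) K) }
    = sInf { s : ℝ | ∃ (W : ∀ k, Matrix (Fin (d (k + 1))) (Fin (d k)) ℝ) (lam : ℕ → ℝ)
        (u : ∀ (_ : Fin m) (k : ℕ), Fin (d k) → ℝ),
        (∀ k < K, ∀ j l, W k j l ∈ Set.Icc (-1 : ℝ) 1) ∧
        (∀ k < K, lam k ∈ Set.Icc (-1 : ℝ) 1) ∧
        (∀ i, ∀ k, 1 ≤ k → k ≤ K → ∀ j, u i k j = 0 ∨ u i k j = 1) ∧
        (∀ i j, (W 0).mulVec (x i) j < M 0 * u i 1 j + lam 0) ∧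
        (∀ i j, M 0 * (u i 1 j - 1) + lam 0 ≤ (W 0).mulVec (x i) j) ∧
        (∀ i, ∀ k, 1 ≤ k → k < K → ∀ j,
          (W k).mulVec (u i k) j < M k * u i (k + 1) j + lam k) ∧
        (∀ i, ∀ k, 1 ≤ k → k < K → ∀ j,
          M k * (u i (k + 1) j - 1) + lam k ≤ (W k).mulVec (u i k) j) ∧
        s = ∑ i, loss (y i) (u i K) } := by
  congr 1
  ext s
  constructor
  · rintro ⟨W, lam, rfl⟩
    choose c hc hW hl using fun k => exists_scale (W k) (lam k)
    have hbin : ∀ i k, 1 ≤ k → ∀ j, bdnn d (fun k => c k • W k) (fun k => c k * lam k) (x i) k j = 0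
        ∨ bdnn d (fun k => c k • W k) (fun k => c k * lam k) (x i) k j = 1 := by
      intro i k hk j
      obtain ⟨k, rfl⟩ := Nat.exists_eq_add_of_le' hk
      exact bdnn_succ_eq_zero_or_one ..
    have hfirst := fun i j => bigM_threshold (l := c 0 * lam 0)
      (abs_mulVec_le (c 0 • W 0) (x i) r j (hW 0 j) fun l =>
        (Real.abs_le_sqrt (Finset.single_le_sum (f := fun l => x i l ^ 2)
          (fun _ _ => sq_nonneg _) (Finset.mem_univ l))).trans (hx i)) (hl 0) (hd0 ▸ hM1)
    have hlater := fun i k (hk : 1 ≤ k) (hkK : k < K) j =>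
      bigM_threshold (l := c k * lam k)
        (abs_mulVec_le (c k • W k)
          (bdnn d (fun k => c k • W k) (fun k => c k * lam k) (x i) k) 1 j (hW k j) fun l => by
            rcases hbin i k hk l with h | h <;> simp [h]) (hl k)
        (by rw [mul_one]; exact hMk k hk hkK)
    refine ⟨fun k => c k • W k, fun k => c k * lam k,
      fun i k => bdnn d (fun k => c k • W k) (fun k => c k * lam k) (x i) k,
      fun k _ j l => abs_le.1 (hW k j l), fun k _ => abs_le.1 (hl k),
      fun i k hk _ => hbin i k hk, fun i j => (hfirst i j).1, fun i j => (hfirst i j).2,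
      fun i k hk hkK j => (hlater i k hk hkK j).1,
      fun i k hk hkK j => (hlater i k hk hkK j).2, ?_⟩
    simp only [bdnn_smul d W lam c hc]
  · rintro ⟨W, lam, u, -, -, hu, h₁, h₂, h₃, h₄, rfl⟩
    have key : ∀ i k, 1 ≤ k → k ≤ K → bdnn d W lam (x i) k = u i k := by
      intro i k hk
      induction k, hk using Nat.le_induction with
      | base =>
        intro h
        funext j
        exact threshold_of_bigM (hu i 1 le_rfl h j) (h₁ i j) (h₂ i j)
      | succ k hk ih =>
        intro h
        funext j
        simp only [bdnn, ih (Nat.le_of_succ_le h)]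
        exact threshold_of_bigM (hu i (k + 1) (Nat.le_add_left 1 k) h j) (h₃ i k hk h j)
          (h₄ i k hk h j)
    exact ⟨W, lam, Finset.sum_congr rfl fun i _ => by rw [key i K hK le_rfl]⟩
end

section
/- Let n ≥ 1, r ≥ 0, and let x ∈ ℝⁿ with ‖x‖₂ ≤ r. Let W^k ∈ ℝ^{d_k×d_{k-1}} (k = 1,…,K, with d₀ = n) have all entries in [−1,1], let λ_k ∈ [−1,1], let M₁ > n·r + 1 and M_k > d_{k-1} + 1 for k ≥ 2, and let u^k ∈ {0,1}^{d_k} for k = 1,…,K. Suppose the following constraints hold componentwise: W¹x < M₁u¹ + λ₁𝟙, W¹x ≥ M₁(u¹ − 𝟙) + λ₁𝟙, and for each k = 2,…,K: W^k u^{k−1} < M_k u^k + λ_k𝟙, W^k u^{k−1} ≥ M_k(u^k − 𝟙) + λ_k𝟙. Then for every k, u^k equals the k-th layer output of the binarized network on input x; in particular u^K = f_{W,λ}(x). -/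
/-- A binary variable `v` satisfying the two big-M constraints for the activation value `a` and
threshold `t` is the indicator of `t ≤ a`. -/
theorem eq_ite_of_bigM {a t m v : ℝ} (hv : v = 0 ∨ v = 1)
    (hlt : a < m * v + t) (hle : m * (v - 1) + t ≤ a) : v = if t ≤ a then 1 else 0 := by
  rcases hv with rfl | rfl
  · rw [if_neg (by linarith)]
  · rw [if_pos (by linarith)]

/-- Any binary variables `u^k` satisfying the big-M constraints of the MIP formulation
coincide with the layer outputs of the binarized network; in particular `u^K = f_{W,λ}(x)`. -/
theorem stmt6 (K : ℕ) (hK : 1 ≤ K) (d : ℕ → ℕ) (r : ℝ) (hr : 0 ≤ r) (hn : 1 ≤ d 0)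
    (x : Fin (d 0) → ℝ) (hx : Real.sqrt (∑ l, x l ^ 2) ≤ r)
    (W : ∀ k, Matrix (Fin (d (k + 1))) (Fin (d k)) ℝ)
    (hW : ∀ k < K, ∀ j l, W k j l ∈ Set.Icc (-1 : ℝ) 1)
    (lam : ℕ → ℝ) (hlam : ∀ k < K, lam k ∈ Set.Icc (-1 : ℝ) 1)
    (M : ℕ → ℝ) (hM1 : (d 0 : ℝ) * r + 1 < M 0)
    (hMk : ∀ k, 1 ≤ k → k < K → (d k : ℝ) + 1 < M k)
    (u : ∀ k, Fin (d k) → ℝ)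
    (hu : ∀ k, 1 ≤ k → k ≤ K → ∀ j, u k j = 0 ∨ u k j = 1)
    (c1 : ∀ j, (W 0).mulVec x j < M 0 * u 1 j + lam 0)
    (c2 : ∀ j, M 0 * (u 1 j - 1) + lam 0 ≤ (W 0).mulVec x j)
    (c3 : ∀ k, 1 ≤ k → k < K → ∀ j, (W k).mulVec (u k) j < M k * u (k + 1) j + lam k)
    (c4 : ∀ k, 1 ≤ k → k < K → ∀ j, M k * (u (k + 1) j - 1) + lam k ≤ (W k).mulVec (u k) j) :
    ∀ k, 1 ≤ k → k ≤ K → u k = bdnn d W lam x k := by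
  intro k hk hkK
  induction k, hk using Nat.le_induction with
  | base =>
    funext j
    exact eq_ite_of_bigM (hu 1 le_rfl hkK j) (c1 j) (c2 j)
  | succ k hk ih =>
    funext j
    have h := eq_ite_of_bigM (hu (k + 1) (by omega) hkK j) (c3 k hk hkK j) (c4 k hk hkK j)
    rw [ih (by omega)] at h
    exact h
end

section
/- Let f_{W,λ} be a binarized deep neural network with K layers, first-layer weight matrix W¹ with rows w¹₁,…,w¹_{d₁} and first-layer threshold λ₁, let x ∈ ℝⁿ, let r ≥ 0, and let u ∈ {0,1}^{d₁}. Suppose that for every j: if u_j = 1 then (w¹_j)ᵀx − r‖w¹_j‖₂ ≥ λ₁, and if u_j = 0 then (w¹_j)ᵀx + r‖w¹_j‖₂ < λ₁. Then for every δ ∈ ℝⁿ with ‖δ‖₂ ≤ r, the first-layer activation of x + δ equals u, and consequently f_{W,λ}(x + δ) = f_{W,λ}(x). That is, the robust constraints guarantee that the network output is invariant under all data perturbations in the Euclidean uncertainty ball of radius r. -/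
/-- Cauchy–Schwarz for the Euclidean norm, on a ball of radius `r`. -/
theorem abs_dotProduct_le_mul_sqrt {ι : Type*} [Fintype ι] (w δ : ι → ℝ) {r : ℝ}
    (hδ : Real.sqrt (∑ l, δ l ^ 2) ≤ r) :
    |w ⬝ᵥ δ| ≤ r * Real.sqrt (∑ l, w l ^ 2) := by
  have h : |w ⬝ᵥ δ| ≤ Real.sqrt (∑ l, w l ^ 2) * Real.sqrt (∑ l, δ l ^ 2) := by
    rw [← Real.sqrt_mul (Finset.sum_nonneg fun _ _ => sq_nonneg _)]
    exact Real.abs_le_sqrt (Finset.sum_mul_sq_le_sq_mul_sq _ _ _)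
  rw [mul_comm r]
  exact h.trans (mul_le_mul_of_nonneg_left hδ (Real.sqrt_nonneg _))

/-- If two inputs have the same first-layer activation, they agree at all later layers. -/
theorem bdnn_succ_congr (d : ℕ → ℕ) (W : ∀ k, Matrix (Fin (d (k + 1))) (Fin (d k)) ℝ)
    (lam : ℕ → ℝ) {x y : Fin (d 0) → ℝ} (h : bdnn d W lam x 1 = bdnn d W lam y 1) (k : ℕ) :
    bdnn d W lam x (k + 1) = bdnn d W lam y (k + 1) := by
  induction k with
  | zero => exact h
  | succ k ih => rw [bdnn, ih, ← bdnn]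

/-- The robust first-layer constraints guarantee that for every perturbation `δ` in the
Euclidean ball of radius `r`, the first-layer activation of `x + δ` equals `u`, and
consequently the BDNN output is invariant: `f(x + δ) = f(x)`. -/
theorem stmt13 (K : ℕ) (hK : 1 ≤ K) (d : ℕ → ℕ)
    (W : ∀ k, Matrix (Fin (d (k + 1))) (Fin (d k)) ℝ) (lam : ℕ → ℝ)
    (x : Fin (d 0) → ℝ) (r : ℝ) (hr : 0 ≤ r)
    (u : Fin (d 1) → ℝ) (hu : ∀ j, u j = 0 ∨ u j = 1)
    (h1 : ∀ j, u j = 1 →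
      lam 0 ≤ (W 0).mulVec x j - r * Real.sqrt (∑ l, W 0 j l ^ 2))
    (h0 : ∀ j, u j = 0 →
      (W 0).mulVec x j + r * Real.sqrt (∑ l, W 0 j l ^ 2) < lam 0) :
    ∀ δ : Fin (d 0) → ℝ, Real.sqrt (∑ l, δ l ^ 2) ≤ r →
      bdnn d W lam (fun l => x l + δ l) 1 = u ∧
      bdnn d W lam (fun l => x l + δ l) K = bdnn d W lam x K := by
  have activation (δ : Fin (d 0) → ℝ) (hδ : Real.sqrt (∑ l, δ l ^ 2) ≤ r) :
      bdnn d W lam (fun l => x l + δ l) 1 = u := by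
    funext j
    have hadd : (W 0).mulVec (fun l => x l + δ l) j = (W 0).mulVec x j + W 0 j ⬝ᵥ δ :=
      congrFun (Matrix.mulVec_add (W 0) x δ) j
    have hb := abs_le.mp (abs_dotProduct_le_mul_sqrt (W 0 j) δ hδ)
    simp only [bdnn, hadd]
    rcases hu j with h | h
    · rw [h, if_neg]
      linarith [h0 j h]
    · rw [h, if_pos]
      linarith [h1 j h]
  intro δ hδ
  have hx : bdnn d W lam x 1 = u := by simpa using activation 0 (by simpa using hr)
  obtain ⟨k, rfl⟩ := Nat.exists_eq_add_of_le' hK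
  exact ⟨activation δ hδ, bdnn_succ_congr d W lam ((activation δ hδ).trans hx.symm) k⟩
end
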